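/- There is a unique semilinear automorphism of order 2 of the BMW algebra B of a simply laced Coxeter diagram determined by g_i ↦ -g_i^{-1}, e_i ↦ e_i, together with the field automorphism of Q(l,x) sending l ↦ -l^{-1} and fixing m = (l - l^{-1})/(1 - x); moreover it commutes with the reversal anti-involution op. -/

import Mathlib

noncomputable section

/-- The base field ℚ(l,x): rational functions in two variables over ℚ. -/
abbrev BMWField : Type := FractionRing (MvPolynomial (Fin 2) ℚ)

/-- The parameter `l`. -/
def lP : BMWField := algebraMap (MvPolynomial (Fin 2) ℚ) BMWField (MvPolynomial.X 0)

/-- The parameter `x`. -/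
def xP : BMWField := algebraMap (MvPolynomial (Fin 2) ℚ) BMWField (MvPolynomial.X 1)

/-- The parameter `m = (l - l⁻¹)/(1 - x)`. -/
def mP : BMWField := (lP - lP⁻¹) / (1 - xP)

/-- The free algebra on generators `g_i` (left summand) and `e_i` (right summand). -/
abbrev BMWFree (n : ℕ) : Type := FreeAlgebra BMWField (Fin n ⊕ Fin n)

/-- The generator `g_i` of the free algebra. -/
def Gf (n : ℕ) (i : Fin n) : BMWFree n := FreeAlgebra.ι BMWField (Sum.inl i)

/-- The generator `e_i` of the free algebra. -/
def Ef (n : ℕ) (i : Fin n) : BMWFree n := FreeAlgebra.ι BMWField (Sum.inr i)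

/-- The defining relations (B1), (B2), (D1), (R1), (R2) of the BMW algebra of a
simply laced diagram on `n` nodes with adjacency relation `adj`. -/
inductive BMWRel (n : ℕ) (adj : Fin n → Fin n → Prop) : BMWFree n → BMWFree n → Prop
  | comm (i j : Fin n) (hne : i ≠ j) (h : ¬ adj i j) :
      BMWRel n adj (Gf n i * Gf n j) (Gf n j * Gf n i)
  | braid (i j : Fin n) (h : adj i j) :
      BMWRel n adj (Gf n i * Gf n j * Gf n i) (Gf n j * Gf n i * Gf n j)
  | defE (i : Fin n) :
      BMWRel n adj (mP • Ef n i) (lP • (Gf n i * Gf n i + mP • Gf n i - 1))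
  | ge (i : Fin n) :
      BMWRel n adj (Gf n i * Ef n i) (lP⁻¹ • Ef n i)
  | ege (i j : Fin n) (h : adj i j) :
      BMWRel n adj (Ef n i * Gf n j * Ef n i) (lP • Ef n i)

/-- The BMW algebra of the diagram, over ℚ(l,x). -/
abbrev BMW (n : ℕ) (adj : Fin n → Fin n → Prop) : Type := RingQuot (BMWRel n adj)

/-- The generator `g_i` of the BMW algebra. -/
def gg (n : ℕ) (adj : Fin n → Fin n → Prop) (i : Fin n) : BMW n adj :=
  RingQuot.mkAlgHom BMWField (BMWRel n adj) (Gf n i)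

/-- The generator `e_i` of the BMW algebra. -/
def ee (n : ℕ) (adj : Fin n → Fin n → Prop) (i : Fin n) : BMW n adj :=
  RingQuot.mkAlgHom BMWField (BMWRel n adj) (Ef n i)

/-- `g_i + m - m e_i`, the inverse of `g_i`, for abstract `g` and `e`. -/
def skeinInv {K A : Type*} [Field K] [Ring A] [Algebra K A] (m : K) (g e : A) : A :=
  g + m • 1 - m • e

section Skein

variable {K A : Type*} [Field K] [Ring A] [Algebra K A] {l m x : K} {g e g' e' : A}

theorem skein_semiconj (hm : m ≠ 0) (hE : m • e = l • (g * g + m • g - 1))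
    (hE' : m • e' = l • (g' * g' + m • g' - 1)) {w : A} (h : w * g = g' * w) :
    w * e = e' * w := by
  apply smul_right_injective A hm
  change m • (w * e) = m • (e' * w)
  have h2 : w * (g * g) = g' * g' * w := by rw [← mul_assoc, h, mul_assoc, h, mul_assoc]
  rw [← mul_smul_comm, ← smul_mul_assoc, hE, hE', mul_smul_comm, smul_mul_assoc, mul_sub, sub_mul,
    mul_add, add_mul, mul_smul_comm, smul_mul_assoc, h, h2, mul_one, one_mul]

theorem mul_skeinInv (hl : l ≠ 0) (hE : m • e = l • (g * g + m • g - 1))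
    (hge : g * e = l⁻¹ • e) : g * skeinInv m g e = 1 := by
  have h : l⁻¹ • m • e = g * g + m • g - 1 := by rw [hE, inv_smul_smul₀ hl]
  rw [skeinInv, mul_sub, mul_add, mul_smul_comm, mul_smul_comm, mul_one, hge, smul_comm m, h]
  abel

theorem skein_commute (hm : m ≠ 0) (hE : m • e = l • (g * g + m • g - 1)) : g * e = e * g :=
  skein_semiconj hm hE hE rfl

theorem skeinInv_mul (hl : l ≠ 0) (hm : m ≠ 0) (hE : m • e = l • (g * g + m • g - 1))
    (hge : g * e = l⁻¹ • e) : skeinInv m g e * g = 1 := by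
  rw [← mul_skeinInv hl hE hge, skeinInv, mul_sub, sub_mul, mul_add, add_mul, mul_smul_comm,
    smul_mul_assoc, mul_smul_comm, smul_mul_assoc, one_mul, mul_one, skein_commute hm hE]

theorem skeinInv_mul_e (hl : l ≠ 0) (hm : m ≠ 0) (hE : m • e = l • (g * g + m • g - 1))
    (hge : g * e = l⁻¹ • e) : skeinInv m g e * e = l • e := by
  have h : skeinInv m g e * (g * e) = e := by
    rw [← mul_assoc, skeinInv_mul hl hm hE hge, one_mul]
  rw [hge, mul_smul_comm] at h
  rw [← smul_inv_smul₀ hl (skeinInv m g e * e), h]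

/-- The quadratic relation for `-g⁻¹`, with `l` replaced by `-l⁻¹`. -/
theorem skein_neg_inv (hl : l ≠ 0) (hm : m ≠ 0) (hE : m • e = l • (g * g + m • g - 1))
    (hge : g * e = l⁻¹ • e) :
    m • e = (-l⁻¹) • (-skeinInv m g e * -skeinInv m g e + m • -skeinInv m g e - 1) := by
  have h1 : skeinInv m g e * (g - m • e) = 1 - m • l • e := by
    rw [mul_sub, mul_smul_comm, skeinInv_mul hl hm hE hge, skeinInv_mul_e hl hm hE hge]
  have h2 : skeinInv m g e * skeinInv m g e
      = skeinInv m g e * (g - m • e) + m • skeinInv m g e := by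
    nth_rewrite 2 [skeinInv]
    rw [add_sub_right_comm, mul_add, mul_smul_comm, mul_one]
  rw [neg_mul_neg, h2, h1]
  match_scalars <;> field_simp <;> ring

theorem skein_e_mul_e (hl : l ≠ 0) (hm : m ≠ 0) (hx : l - l⁻¹ = m * (1 - x))
    (hE : m • e = l • (g * g + m • g - 1)) (hge : g * e = l⁻¹ • e) : e * e = x • e := by
  have h : m • (e * e) = l • (l⁻¹ • l⁻¹ • e + m • l⁻¹ • e - e) := by
    rw [← smul_mul_assoc, hE, smul_mul_assoc, sub_mul, add_mul, one_mul, smul_mul_assoc, mul_assoc,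
      hge, mul_smul_comm, hge]
  apply smul_right_injective A hm
  change m • (e * e) = m • x • e
  rw [h]
  match_scalars
  field_simp
  field_simp at hx
  linear_combination -hx

theorem skein_e_inv_e (hl : l ≠ 0) (hm : m ≠ 0) (hx : l - l⁻¹ = m * (1 - x)) (hlm : 1 + l * m ≠ 0)
    (hE : m • e = l • (g * g + m • g - 1)) (hge : g * e = l⁻¹ • e)
    (hE' : m • e' = l • (g' * g' + m • g' - 1)) (hge' : g' * e' = l⁻¹ • e')
    (hbraid : g * g' * g = g' * g * g') (hege : e * g' * e = l • e) :
    e * skeinInv m g' e' * e = l⁻¹ • e := by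
  have hw : g * g' * e = e' * (g * g') :=
    skein_semiconj hm hE hE' (by rw [hbraid, mul_assoc])
  have h1 : e * e' * (g * g') = e := by
    rw [mul_assoc, ← hw, ← mul_assoc, ← mul_assoc, ← skein_commute hm hE, hge, smul_mul_assoc,
      smul_mul_assoc, hege, inv_smul_smul₀ hl]
  have h2 : e * e' = e * skeinInv m g' e' * skeinInv m g e := by
    nth_rewrite 2 [← h1]
    rw [mul_assoc _ (g * g'), mul_assoc g, mul_skeinInv hl hE' hge', mul_one, mul_assoc,
      mul_skeinInv hl hE hge, mul_one]
  have h3 : e * e' * e = l • (e * skeinInv m g' e' * e) := by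
    rw [h2, mul_assoc _ _ e, skeinInv_mul_e hl hm hE hge, mul_smul_comm]
  have h4 : e * skeinInv m g' e' * e = l • e + m • x • e - m • (e * e' * e) := by
    nth_rewrite 1 [skeinInv]
    rw [mul_sub, sub_mul, mul_add, add_mul, mul_smul_comm, smul_mul_assoc, mul_smul_comm,
      smul_mul_assoc, mul_one, hege, skein_e_mul_e hl hm hx hE hge]
  rw [h3] at h4
  apply smul_right_injective A hlm
  change (1 + l * m) • (e * skeinInv m g' e' * e) = (1 + l * m) • l⁻¹ • e
  have h5 : (1 + l * m) • l⁻¹ • e = l • e + m • x • e := by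
    match_scalars
    field_simp
    field_simp at hx
    linear_combination -hx
  rw [h5, add_smul, one_smul, mul_comm l m, mul_smul]
  nth_rewrite 1 [h4]
  abel

end Skein

theorem inverse_braid {M : Type*} [Monoid M] {a b u v : M} (hau : a * u = 1) (hua : u * a = 1)
    (hbv : b * v = 1) (hvb : v * b = 1) (h : a * b * a = b * a * b) :
    u * v * u = v * u * v := by
  let a' : Mˣ := ⟨a, u, hau, hua⟩
  let b' : Mˣ := ⟨b, v, hbv, hvb⟩
  have h' : a' * b' * a' = b' * a' * b' := Units.ext h
  have := congrArg (fun w : Mˣ => ((w⁻¹ : Mˣ) : M)) h'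
  simpa [a', b', mul_assoc] using this

theorem inverse_comm {M : Type*} [Monoid M] {a b u v : M} (hau : a * u = 1) (hua : u * a = 1)
    (hbv : b * v = 1) (hvb : v * b = 1) (h : a * b = b * a) : u * v = v * u := by
  let a' : Mˣ := ⟨a, u, hau, hua⟩
  let b' : Mˣ := ⟨b, v, hbv, hvb⟩
  have h' : a' * b' = b' * a' := Units.ext h
  have := congrArg (fun w : Mˣ => ((w⁻¹ : Mˣ) : M)) h'
  simpa [a', b'] using this.symm

theorem algebraMap_BMWField_injective :
    Function.Injective (algebraMap (MvPolynomial (Fin 2) ℚ) BMWField) :=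
  IsFractionRing.injective _ _

theorem lP_ne_zero : lP ≠ 0 := by
  rw [lP, Ne, map_eq_zero_iff _ algebraMap_BMWField_injective]
  exact MvPolynomial.X_ne_zero 0

theorem one_sub_xP_ne_zero : 1 - xP ≠ 0 := by
  rw [xP, ← map_one (algebraMap (MvPolynomial (Fin 2) ℚ) BMWField), ← map_sub, Ne,
    map_eq_zero_iff _ algebraMap_BMWField_injective]
  intro h
  simpa using congrArg (MvPolynomial.eval 0) h

theorem lP_sub_inv_ne_zero : lP - lP⁻¹ ≠ 0 := by
  intro h
  have hl := lP_ne_zero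
  have h : lP ^ 2 - 1 = 0 := by
    field_simp at h
    linear_combination h
  rw [lP, ← map_pow, ← map_one (algebraMap (MvPolynomial (Fin 2) ℚ) BMWField), ← map_sub,
    map_eq_zero_iff _ algebraMap_BMWField_injective] at h
  simpa using congrArg (MvPolynomial.eval 0) h

theorem mP_ne_zero : mP ≠ 0 :=
  div_ne_zero lP_sub_inv_ne_zero one_sub_xP_ne_zero

theorem lP_sub_inv_eq : lP - lP⁻¹ = mP * (1 - xP) := by
  rw [mP, div_mul_cancel₀ _ one_sub_xP_ne_zero]

theorem one_add_lP_mul_mP_ne_zero : 1 + lP * mP ≠ 0 := by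
  have hl := lP_ne_zero
  have hx := one_sub_xP_ne_zero
  intro h
  have h' : lP ^ 2 - xP = 0 := by
    rw [mP] at h
    field_simp at h
    linear_combination h
  rw [lP, xP, ← map_pow, ← map_sub, map_eq_zero_iff _ algebraMap_BMWField_injective] at h'
  simpa using congrArg (MvPolynomial.eval ![1, 0]) h'

theorem BMWField_involutive {σ : BMWField ≃+* BMWField} (hσl : σ lP = -lP⁻¹) (hσx : σ xP = xP)
    (c : BMWField) : σ (σ c) = c := by
  suffices h : (σ : BMWField →+* BMWField).comp σ = RingHom.id _ from RingHom.congr_fun h c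
  apply IsLocalization.ringHom_ext (nonZeroDivisors (MvPolynomial (Fin 2) ℚ))
  apply MvPolynomial.ringHom_ext
  · intro r
    have h := RingHom.ext_iff.1 (Subsingleton.elim
      ((((σ : BMWField →+* BMWField).comp (σ : BMWField →+* BMWField)).comp
        (algebraMap (MvPolynomial (Fin 2) ℚ) BMWField)).comp MvPolynomial.C)
      (((RingHom.id _).comp (algebraMap (MvPolynomial (Fin 2) ℚ) BMWField)).comp
        MvPolynomial.C)) r
    exact h
  · intro i
    fin_cases i
    · change σ (σ lP) = lP
      rw [hσl, map_neg, map_inv₀, hσl, inv_neg, inv_inv, neg_neg]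
    · change σ (σ xP) = xP
      rw [hσx, hσx]

/-- Elements `g_i`, `e_i` of an algebra over `ℚ(l,x)` satisfying the defining relations of the BMW
algebra. -/
structure IsBMWFamily {n : ℕ} (adj : Fin n → Fin n → Prop) {A : Type*} [Ring A]
    [Algebra BMWField A] (g e : Fin n → A) : Prop where
  comm : ∀ i j, i ≠ j → ¬ adj i j → g i * g j = g j * g i
  braid : ∀ i j, adj i j → g i * g j * g i = g j * g i * g j
  defE : ∀ i, mP • e i = lP • (g i * g i + mP • g i - 1)
  ge : ∀ i, g i * e i = lP⁻¹ • e i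
  ege : ∀ i j, adj i j → e i * g j * e i = lP • e i

namespace BMW

variable {n : ℕ} {adj : Fin n → Fin n → Prop}

theorem isBMWFamily : IsBMWFamily adj (gg n adj) (ee n adj) where
  comm i j hne h := by
    have := RingQuot.mkAlgHom_rel BMWField (BMWRel.comm i j hne h)
    simp only [map_mul] at this
    exact this
  braid i j h := by
    have := RingQuot.mkAlgHom_rel BMWField (BMWRel.braid i j h)
    simp only [map_mul] at this
    exact this
  defE i := by
    have := RingQuot.mkAlgHom_rel BMWField (BMWRel.defE (adj := adj) i)
    simp only [map_smul, map_sub, map_add, map_mul, map_one] at this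
    exact this
  ge i := by
    have := RingQuot.mkAlgHom_rel BMWField (BMWRel.ge (adj := adj) i)
    simp only [map_smul, map_mul] at this
    exact this
  ege i j h := by
    have := RingQuot.mkAlgHom_rel BMWField (BMWRel.ege i j h)
    simp only [map_smul, map_mul] at this
    exact this

theorem adjoin_eq_top :
    Algebra.adjoin BMWField (Set.range (gg n adj) ∪ Set.range (ee n adj)) = ⊤ := by
  rw [eq_top_iff]
  rintro b -
  obtain ⟨a, rfl⟩ := RingQuot.mkAlgHom_surjective BMWField (BMWRel n adj) b
  induction a using FreeAlgebra.induction with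
  | grade0 r => rw [AlgHom.commutes]; exact Subalgebra.algebraMap_mem _ r
  | grade1 i =>
    apply Algebra.subset_adjoin
    exact i.rec (fun i => Or.inl ⟨i, rfl⟩) (fun i => Or.inr ⟨i, rfl⟩)
  | mul a b ha hb => rw [map_mul]; exact mul_mem ha hb
  | add a b ha hb => rw [map_add]; exact add_mem ha hb

/-- The universal property of the BMW algebra, for rings over which `ℚ(l,x)` acts through `φ`. -/
theorem exists_lift {A : Type*} [Ring A] (φ : BMWField →+* A) (hφ : ∀ c a, φ c * a = a * φ c)
    (g e : Fin n → A)
    (hcomm : ∀ i j, i ≠ j → ¬ adj i j → g i * g j = g j * g i)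
    (hbraid : ∀ i j, adj i j → g i * g j * g i = g j * g i * g j)
    (hE : ∀ i, φ mP * e i = φ lP * (g i * g i + φ mP * g i - 1))
    (hge : ∀ i, g i * e i = φ lP⁻¹ * e i)
    (hege : ∀ i j, adj i j → e i * g j * e i = φ lP * e i) :
    ∃ f : BMW n adj →+* A, (∀ c, f (algebraMap BMWField _ c) = φ c) ∧
      (∀ i, f (gg n adj i) = g i) ∧ ∀ i, f (ee n adj i) = e i := by
  let : Algebra BMWField A := φ.toAlgebra' hφ
  let F : BMWFree n →ₐ[BMWField] A := FreeAlgebra.lift BMWField (Sum.elim g e)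
  have hFg (i) : F (Gf n i) = g i := FreeAlgebra.lift_ι_apply _ _
  have hFe (i) : F (Ef n i) = e i := FreeAlgebra.lift_ι_apply _ _
  have hs (c : BMWField) (a : A) : c • a = φ c * a := rfl
  have hF : ∀ ⦃a b⦄, BMWRel n adj a b → F a = F b := by
    intro a b h
    cases h with
    | comm i j hne h => simpa only [map_mul, hFg] using hcomm i j hne h
    | braid i j h => simpa only [map_mul, hFg] using hbraid i j h
    | defE i =>
      simpa only [map_smul, map_sub, map_add, map_mul, map_one, hFg, hFe, hs] using hE i
    | ge i => simpa only [map_smul, map_mul, hFg, hFe, hs] using hge i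
    | ege i j h => simpa only [map_smul, map_mul, hFg, hFe, hs] using hege i j h
  let f := RingQuot.liftAlgHom BMWField ⟨F, hF⟩
  refine ⟨f, fun c => f.commutes c, fun i => ?_, fun i => ?_⟩
  · rw [← hFg]; exact RingQuot.liftAlgHom_mkAlgHom_apply _ _ _ _
  · rw [← hFe]; exact RingQuot.liftAlgHom_mkAlgHom_apply _ _ _ _

end BMW

namespace IsBMWFamily

variable {n : ℕ} {adj : Fin n → Fin n → Prop} {A : Type*} [Ring A] [Algebra BMWField A]
  {g e : Fin n → A}

/-- The inverse `g_i + m - m e_i` of `g_i`. -/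
def gInv (g e : Fin n → A) (i : Fin n) : A :=
  skeinInv mP (g i) (e i)

theorem mul_gInv (hF : IsBMWFamily adj g e) (i : Fin n) : g i * gInv g e i = 1 :=
  mul_skeinInv lP_ne_zero (hF.defE i) (hF.ge i)

theorem gInv_mul (hF : IsBMWFamily adj g e) (i : Fin n) : gInv g e i * g i = 1 :=
  skeinInv_mul lP_ne_zero mP_ne_zero (hF.defE i) (hF.ge i)

theorem inverse_eq (hF : IsBMWFamily adj g e) (i : Fin n) : Ring.inverse (g i) = gInv g e i :=
  Ring.inverse_unit (⟨_, _, hF.mul_gInv i, hF.gInv_mul i⟩ : Aˣ)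

@[elab_as_elim]
theorem induction (hgen : Algebra.adjoin BMWField (Set.range g ∪ Set.range e) = ⊤)
    {P : A → Prop} (scalar : ∀ c, P (algebraMap BMWField _ c))
    (gen_g : ∀ i, P (g i)) (gen_e : ∀ i, P (e i))
    (add : ∀ a b, P a → P b → P (a + b)) (mul : ∀ a b, P a → P b → P (a * b))
    (b : A) : P b := by
  have hb : b ∈ Algebra.adjoin BMWField (Set.range g ∪ Set.range e) := hgen ▸ Algebra.mem_top
  induction hb using Algebra.adjoin_induction with
  | mem b hb =>
    rcases hb with ⟨i, rfl⟩ | ⟨i, rfl⟩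
    exacts [gen_g i, gen_e i]
  | algebraMap c => exact scalar c
  | add a b _ _ ha hb => exact add a b ha hb
  | mul a b _ _ ha hb => exact mul a b ha hb

theorem exists_semilinear_hom (hF : IsBMWFamily adj g e) {σ : BMWField →+* BMWField}
    (hσl : σ lP = -lP⁻¹) (hσm : σ mP = mP) :
    ∃ f : BMW n adj →+* A,
      (∀ c, f (algebraMap BMWField _ c) = algebraMap BMWField _ (σ c)) ∧
      (∀ i, f (gg n adj i) = -gInv g e i) ∧ ∀ i, f (ee n adj i) = e i := by
  have hl := lP_ne_zero
  apply BMW.exists_lift ((algebraMap BMWField A).comp σ)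
    (fun c a => Algebra.commutes (σ c) a) (fun i => -gInv g e i) e
  · intro i j hne h
    rw [neg_mul_neg, neg_mul_neg]
    exact inverse_comm (hF.mul_gInv i) (hF.gInv_mul i) (hF.mul_gInv j) (hF.gInv_mul j)
      (hF.comm i j hne h)
  · intro i j h
    rw [neg_mul_neg, neg_mul_neg, mul_neg, mul_neg]
    exact congrArg _ (inverse_braid (hF.mul_gInv i) (hF.gInv_mul i) (hF.mul_gInv j)
      (hF.gInv_mul j) (hF.braid i j h))
  · intro i
    simp only [RingHom.comp_apply, hσl, hσm, ← Algebra.smul_def]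
    exact skein_neg_inv hl mP_ne_zero (hF.defE i) (hF.ge i)
  · intro i
    simp only [RingHom.comp_apply, map_inv₀ σ, hσl, ← Algebra.smul_def]
    rw [inv_neg, inv_inv, neg_smul, neg_mul]
    exact congrArg _ (skeinInv_mul_e hl mP_ne_zero (hF.defE i) (hF.ge i))
  · intro i j h
    simp only [RingHom.comp_apply, hσl, ← Algebra.smul_def]
    rw [mul_neg, neg_mul, neg_smul]
    exact congrArg _ (skein_e_inv_e hl mP_ne_zero lP_sub_inv_eq one_add_lP_mul_mP_ne_zero
      (hF.defE i) (hF.ge i) (hF.defE j) (hF.ge j) (hF.braid i j h) (hF.ege i j h))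

/-- A product-reversing map fixing the `g_i` either fixes `1` or vanishes. -/
theorem op_one (hF : IsBMWFamily adj g e)
    (hgen : Algebra.adjoin BMWField (Set.range g ∪ Set.range e) = ⊤) {op : A → A}
    (hmul : ∀ a b, op (a * b) = op b * op a) (hg : ∀ i, op (g i) = g i) : op 1 = 1 ∨ ∀ b, op b = 0 := by
  rcases isEmpty_or_nonempty (Fin n) with hn | ⟨⟨i⟩⟩
  · have hsc (b : A) : ∃ c : BMWField, algebraMap BMWField _ c = b := by
      induction b using induction hgen with
      | scalar c => exact ⟨c, rfl⟩
      | gen_g i => exact hn.elim i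
      | gen_e i => exact hn.elim i
      | add a b ha hb =>
        obtain ⟨⟨c, rfl⟩, ⟨d, rfl⟩⟩ := And.intro ha hb
        exact ⟨c + d, map_add _ _ _⟩
      | mul a b ha hb =>
        obtain ⟨⟨c, rfl⟩, ⟨d, rfl⟩⟩ := And.intro ha hb
        exact ⟨c * d, map_mul _ _ _⟩
    obtain ⟨c, hc⟩ := hsc (op 1)
    by_cases h0 : c = 0
    · right
      intro b
      have h1 : op 1 = 0 := by rw [← hc, h0, map_zero]
      rw [← mul_one b, hmul, h1, zero_mul]
    · left
      have hidem : op 1 * op 1 = op 1 := by rw [← hmul, mul_one]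
      calc op 1 = algebraMap BMWField A c⁻¹ * (op 1 * op 1) := by
            rw [← mul_assoc, ← hc, ← map_mul, inv_mul_cancel₀ h0, map_one, one_mul]
        _ = 1 := by rw [hidem, ← hc, ← map_mul, inv_mul_cancel₀ h0, map_one]
  · left
    have h : g i * op 1 = g i := by
      have := hmul 1 (g i)
      rwa [one_mul, hg, eq_comm] at this
    calc op 1 = gInv g e i * (g i * op 1) := by rw [← mul_assoc, hF.gInv_mul, one_mul]
      _ = 1 := by rw [h, hF.gInv_mul]

theorem op_e (hF : IsBMWFamily adj g e) {op : A → A} (hadd : ∀ a b, op (a + b) = op a + op b)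
    (hmul : ∀ a b, op (a * b) = op b * op a)
    (hsmul : ∀ (c : BMWField) (b : A), op (c • b) = c • op b)
    (hg : ∀ i, op (g i) = g i) (h1 : op 1 = 1) (i : Fin n) :
    op (e i) = e i := by
  apply smul_right_injective _ mP_ne_zero
  change mP • op (e i) = mP • e i
  have hsub : ∀ a b, op (a - b) = op a - op b := map_sub (AddMonoidHom.mk' op hadd)
  rw [← hsmul, hF.defE, hsmul, hsub, hadd, hsmul, hmul, hg, h1]

theorem op_gInv (hF : IsBMWFamily adj g e) {op : A → A} (hadd : ∀ a b, op (a + b) = op a + op b)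
    (hmul : ∀ a b, op (a * b) = op b * op a)
    (hsmul : ∀ (c : BMWField) (b : A), op (c • b) = c • op b)
    (hg : ∀ i, op (g i) = g i) (h1 : op 1 = 1) (i : Fin n) :
    op (gInv g e i) = gInv g e i := by
  have hsub : ∀ a b, op (a - b) = op a - op b := map_sub (AddMonoidHom.mk' op hadd)
  rw [gInv, skeinInv, hsub, hadd, hsmul, hsmul, hg, h1, hF.op_e hadd hmul hsmul hg h1]

theorem exists_involution (hF : IsBMWFamily adj g e)
    (hgen : Algebra.adjoin BMWField (Set.range g ∪ Set.range e) = ⊤)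
    {σ : BMWField ≃+* BMWField} (hσl : σ lP = -lP⁻¹) (hσx : σ xP = xP) (hσm : σ mP = mP)
    {f : A →+* A} (hfc : ∀ c, f (algebraMap BMWField _ c) = algebraMap BMWField _ (σ c))
    (hfg : ∀ i, f (g i) = -gInv g e i) (hfe : ∀ i, f (e i) = e i) :
    ∃ Φ : A ≃+* A,
      (∀ (c : BMWField) (b : A), Φ (c • b) = σ c • Φ b) ∧
      (∀ i, Φ (g i) = - Ring.inverse (g i)) ∧
      (∀ i, Φ (e i) = e i) ∧
      (∀ b, Φ (Φ b) = b) ∧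
      (∀ op : A → A,
        (∀ a b, op (a + b) = op a + op b) →
        (∀ a b, op (a * b) = op b * op a) →
        (∀ (c : BMWField) (b : A), op (c • b) = c • op b) →
        (∀ i, op (g i) = g i) →
        ∀ b, Φ (op b) = op (Φ b)) ∧
      (∀ Ψ : A ≃+* A,
        (∀ (c : BMWField) (b : A), Ψ (c • b) = σ c • Ψ b) →
        (∀ i, Ψ (g i) = - Ring.inverse (g i)) →
        (∀ i, Ψ (e i) = e i) → Ψ = Φ) := by
  have hfs (c : BMWField) (b : A) : f (c • b) = σ c • f b := by
    rw [Algebra.smul_def, map_mul, hfc, Algebra.smul_def]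
  have hff (b : A) : f (f b) = b := by
    induction b using induction hgen with
    | scalar c =>
      rw [hfc, hfc]
      exact congrArg _ (BMWField_involutive hσl hσx c)
    | gen_g i =>
      rw [hfg, map_neg, gInv, skeinInv, map_sub, map_add, hfs, hfs, hσm, hfg, hfe, map_one,
        gInv, skeinInv]
      abel
    | gen_e i => rw [hfe, hfe]
    | add a b ha hb => rw [map_add, map_add, ha, hb]
    | mul a b ha hb => rw [map_mul, map_mul, ha, hb]
  have hcomp : f.comp f = RingHom.id _ := RingHom.ext hff
  refine ⟨RingEquiv.ofRingHom f f hcomp hcomp, hfs, fun i => ?_, hfe, hff, ?_, ?_⟩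
  · rw [hF.inverse_eq]
    exact hfg i
  · intro op hadd hmul hsmul hg b
    change f (op b) = op (f b)
    rcases hF.op_one hgen hmul hg with h1 | h0
    · have hneg : ∀ a, op (-a) = -op a := map_neg (AddMonoidHom.mk' op hadd)
      induction b using induction hgen with
      | scalar c =>
        rw [hfc, Algebra.algebraMap_eq_smul_one, hsmul, Algebra.algebraMap_eq_smul_one, hsmul, h1,
          hfs, map_one]
      | gen_g i => rw [hg, hfg, hneg, hF.op_gInv hadd hmul hsmul hg h1]
      | gen_e i =>
        rw [hF.op_e hadd hmul hsmul hg h1, hfe, hF.op_e hadd hmul hsmul hg h1]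
      | add a b ha hb => rw [hadd, map_add, map_add, hadd, ha, hb]
      | mul a b ha hb => rw [hmul, map_mul, map_mul, hmul, ha, hb]
    · rw [h0, h0, map_zero]
  · intro Ψ hΨs hΨg hΨe
    ext b
    change Ψ b = f b
    induction b using induction hgen with
    | scalar c =>
      rw [hfc, Algebra.algebraMap_eq_smul_one, hΨs, map_one, Algebra.algebraMap_eq_smul_one]
    | gen_g i => rw [hΨg, hfg, hF.inverse_eq]
    | gen_e i => rw [hΨe, hfe]
    | add a b ha hb => rw [map_add, map_add, ha, hb]
    | mul a b ha hb => rw [map_mul, map_mul, ha, hb]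

end IsBMWFamily

/-- There is a unique semilinear (over the field automorphism `σ` of ℚ(l,x) with
`σ(l) = -l⁻¹`, `σ(x) = x`, hence fixing `m`) ring automorphism of the BMW algebra
with `g_i ↦ -g_i⁻¹` and `e_i ↦ e_i`; it has order 2 and commutes with the
reversal anti-involution. -/
theorem bmw_semilinear_involution (n : ℕ) (adj : Fin n → Fin n → Prop)
    (hsym : ∀ i j, adj i j → adj j i) (hirr : ∀ i, ¬ adj i i)
    (σ : BMWField ≃+* BMWField) (hσl : σ lP = -lP⁻¹) (hσx : σ xP = xP)
    (hσm : σ mP = mP) :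
    ∃ Φ : BMW n adj ≃+* BMW n adj,
      (∀ (c : BMWField) (b : BMW n adj), Φ (c • b) = σ c • Φ b) ∧
      (∀ i, Φ (gg n adj i) = - Ring.inverse (gg n adj i)) ∧
      (∀ i, Φ (ee n adj i) = ee n adj i) ∧
      (∀ b, Φ (Φ b) = b) ∧
      (∀ op : BMW n adj → BMW n adj,
        (∀ a b, op (a + b) = op a + op b) →
        (∀ a b, op (a * b) = op b * op a) →
        (∀ (c : BMWField) (b : BMW n adj), op (c • b) = c • op b) →
        (∀ i, op (gg n adj i) = gg n adj i) →
        ∀ b, Φ (op b) = op (Φ b)) ∧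
      (∀ Ψ : BMW n adj ≃+* BMW n adj,
        (∀ (c : BMWField) (b : BMW n adj), Ψ (c • b) = σ c • Ψ b) →
        (∀ i, Ψ (gg n adj i) = - Ring.inverse (gg n adj i)) →
        (∀ i, Ψ (ee n adj i) = ee n adj i) → Ψ = Φ) := by
  obtain ⟨f, hfc, hfg, hfe⟩ :=
    BMW.isBMWFamily.exists_semilinear_hom (adj := adj) (σ := σ) hσl hσm
  exact BMW.isBMWFamily.exists_involution BMW.adjoin_eq_top hσl hσx hσm hfc hfg hfe
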